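/- Let G be a connected Δ-regular finite simple graph of order n with Δ ≥ 3 satisfying (Δ−1)·Z(G) = (Δ−2)·n + 2. Let S be a zero forcing set of G of minimum cardinality among all zero forcing sets whose complement induces a connected subgraph, and let S̄ = V(G)∖S, so that G[S̄] is a tree and every vertex of S has exactly one neighbor in S̄. Let x be a leaf of the tree G[S̄] with |S̄| ≥ 2, and let X = N(x) ∩ S. If X is a clique of G, then there exists a unique vertex y ∈ S such that N(y) = X ∪ {z}, where z is the unique neighbor of y in S̄, and moreover the degree of z in the tree G[S̄] equals Δ − 1. -/

import Mathlib

/-- The zero forcing closure: `v` eventually becomes colored starting from `S`,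
under the rule that a colored vertex all of whose other neighbors are colored
forces its remaining neighbor to become colored. -/
inductive SimpleGraph.ZeroForces {V : Type*} (G : SimpleGraph V) (S : Set V) : V → Prop
  | init {v : V} (hv : v ∈ S) : SimpleGraph.ZeroForces G S v
  | force {u w : V} (hu : SimpleGraph.ZeroForces G S u) (hadj : G.Adj u w)
      (hall : ∀ v, G.Adj u v → v ≠ w → SimpleGraph.ZeroForces G S v) :
      SimpleGraph.ZeroForces G S w

/-- `S` is a zero forcing set of `G` if every vertex eventually becomes colored. -/
def SimpleGraph.IsZeroForcingSet {V : Type*} (G : SimpleGraph V) (S : Set V) : Prop :=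
  ∀ v, G.ZeroForces S v

/-- The zero forcing number of `G`: minimum cardinality of a zero forcing set. -/
noncomputable def SimpleGraph.zeroForcingNumber {V : Type*} (G : SimpleGraph V) : ℕ :=
  sInf {n | ∃ S : Set V, G.IsZeroForcingSet S ∧ S.ncard = n}

namespace SimpleGraph

variable {V : Type*} {G : SimpleGraph V}

theorem ZeroForces.trans {S T : Set V} (hST : ∀ s ∈ S, G.ZeroForces T s) {v : V}
    (hv : G.ZeroForces S v) : G.ZeroForces T v := by
  induction hv with
  | init hv => exact hST _ hv
  | force _ hadj _ ihu ihall => exact .force ihu hadj ihall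

/-- In a tree, a vertex has at most one neighbor that is closer to a given root. -/
theorem IsTree.eq_of_adj_of_dist_lt (hG : G.IsTree) {r u v w : V} (hu : G.Adj u w)
    (hv : G.Adj v w) (hur : G.dist r u < G.dist r w) (hvr : G.dist r v < G.dist r w) :
    u = v := by
  obtain ⟨p, hp, hpl⟩ := hG.connected.exists_path_of_dist r w
  have key {t : V} (ht : G.Adj t w) (htr : G.dist r t < G.dist r w) :
      t = p.penultimate := by
    obtain ⟨q, hq, hql⟩ := hG.connected.exists_path_of_dist r t
    have hqw : (q.concat ht).IsPath := by
      apply Walk.isPath_of_length_eq_dist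
      rw [Walk.length_concat, hql]
      have := hG.dist_eq_dist_add_one_of_adj r ht
      omega
    have := (hG.isAcyclic.subsingleton_path r w).elim ⟨p, hp⟩ ⟨_, hqw⟩
    rw [Subtype.mk.injEq] at this
    rw [this, Walk.penultimate_concat]
  rw [key hu hur, key hv hvr]

theorem ncard_neighborSet_inter_add [Fintype V] [DecidableRel G.Adj] (S : Set V) (v : V) :
    (G.neighborSet v ∩ S).ncard + {w : V | w ∈ Sᶜ ∧ G.Adj v w}.ncard = G.degree v := by
  rw [← G.card_neighborSet_eq_degree, ← Set.toFinset_card, ← Set.ncard_eq_toFinset_card',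
    ← Set.ncard_union_eq]
  · congr 1
    ext w
    by_cases hw : w ∈ S <;> simp [hw]
  · rw [Set.disjoint_left]
    rintro w ⟨-, hw⟩ ⟨hw', -⟩
    exact hw' hw

/-- Counting the edges between a set and its complement, when the complement induces a tree and
every vertex of the set has a single neighbor in the complement. -/
theorem ncard_of_isTree_induce_compl [Fintype V] [DecidableRel G.Adj] {Δ : ℕ} (hΔ : 2 ≤ Δ)
    (hreg : G.IsRegularOfDegree Δ) {S : Set V} (htree : (G.induce Sᶜ).IsTree)
    (hone : ∀ v ∈ S, {w : V | w ∈ Sᶜ ∧ G.Adj v w}.ncard = 1) :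
    (Δ - 1) * S.ncard = (Δ - 2) * Fintype.card V + 2 := by
  classical
  have htedge := htree.card_edgeFinset
  have hsum := (G.induce Sᶜ).sum_degrees_eq_twice_card_edges
  have hdeg (v : ↥Sᶜ) : (G.induce Sᶜ).degree v = {w : V | w ∈ Sᶜ ∧ G.Adj v w}.ncard := by
    rw [← card_neighborSet_eq_degree, ← Nat.card_eq_fintype_card, Nat.card_coe_set_eq,
      ← Set.ncard_image_of_injective _ Subtype.val_injective]
    congr 1
    ext w
    simp [and_comm]
  have hcross : ∑ v : ↥Sᶜ, (G.neighborSet v ∩ S).ncard = S.ncard := by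
    have h := Finset.sum_card_bipartiteAbove_eq_sum_card_bipartiteBelow
      (s := Sᶜ.toFinset) (t := S.toFinset) G.Adj
    have h1 : ∀ v ∈ S.toFinset,
        (Finset.bipartiteBelow G.Adj Sᶜ.toFinset v).card = 1 := by
      intro v hv
      rw [← hone v (by simpa using hv), ← Set.ncard_coe_finset]
      congr 1
      ext w
      simp [G.adj_comm]
    rw [Finset.sum_congr rfl h1, Finset.sum_const, smul_eq_mul, mul_one,
      ← Set.ncard_eq_toFinset_card'] at h
    rw [← h, Finset.sum_subtype (p := (· ∈ Sᶜ)) Sᶜ.toFinset (by simp)]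
    refine Finset.sum_congr rfl fun v _ => ?_
    rw [← Set.ncard_coe_finset]
    congr 1
    ext w
    simp [and_comm]
  have htot : ∑ v : ↥Sᶜ, Δ = ∑ v : ↥Sᶜ, (G.induce Sᶜ).degree v + S.ncard := by
    rw [← hcross, ← Finset.sum_add_distrib]
    refine Finset.sum_congr rfl fun v _ => ?_
    rw [hdeg, add_comm, ncard_neighborSet_inter_add, hreg]
  have hn := Set.ncard_add_ncard_compl S
  rw [Nat.card_eq_fintype_card] at hn
  rw [Finset.sum_const, hsum, Finset.card_univ, smul_eq_mul] at htot
  rw [← Nat.card_eq_fintype_card, Nat.card_coe_set_eq] at htot htedge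
  obtain ⟨d, rfl⟩ := Nat.exists_eq_add_of_le hΔ
  rw [show 2 + d - 1 = d + 1 by omega, show 2 + d - 2 = d by omega, ← hn]
  nlinarith

/-- If the complement of `S` induces a tree, every vertex of `S` has a single neighbor there, and
two vertices `x`, `z` of the tree are colored, then the whole tree becomes colored as soon as all
vertices of `S` attached to the other tree vertices, and their neighbors in `S`, are colored. -/
theorem zeroForces_compl_of_isTree [Fintype V] [DecidableRel G.Adj]
    (hdeg : ∀ v, 3 ≤ G.degree v) {S T : Set V} (htree : (G.induce Sᶜ).IsTree)
    (hone : ∀ s ∈ S, ∀ u ∈ Sᶜ, ∀ w ∈ Sᶜ, G.Adj s u → G.Adj s w → u = w) {x z : V}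
    (hxS : x ∈ Sᶜ) (hx : G.ZeroForces T x) (hz : G.ZeroForces T z)
    (hT : ∀ s ∈ S, ∀ c ∈ Sᶜ, G.Adj s c → c ≠ x → c ≠ z →
      s ∈ T ∧ ∀ u ∈ S, G.Adj s u → u ∈ T) {v : V} (hv : v ∈ Sᶜ) : G.ZeroForces T v := by
  classical
  by_contra hcon
  let d : ↥Sᶜ → ℕ := (G.induce Sᶜ).dist ⟨x, hxS⟩
  obtain ⟨⟨v, hvS⟩, hvU, hmax⟩ := Finset.exists_max_image
    {v : ↥Sᶜ | ¬ G.ZeroForces T v} d ⟨⟨v, hv⟩, by simpa using hcon⟩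
  simp only [Finset.mem_filter_univ] at hvU hmax
  have hvx : v ≠ x := by rintro rfl; exact hvU hx
  have hvz : v ≠ z := by rintro rfl; exact hvU hz
  have hvN : ∀ s, G.Adj v s → s ∈ Sᶜ := by
    intro s hvs hs
    obtain ⟨hsT, hsN⟩ := hT s hs v hvS hvs.symm hvx hvz
    refine hvU (.force (.init hsT) hvs.symm fun u hsu huv => ?_)
    by_cases hu : u ∈ S
    · exact .init (hsN u hu hsu)
    · exact absurd (hone s hs u hu v hvS hsu hvs.symm) huv
  obtain ⟨c, hc, hvc, hcz, hcd⟩ : ∃ c, ∃ hc : c ∈ Sᶜ, G.Adj v c ∧ c ≠ z ∧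
      d ⟨v, hvS⟩ < d ⟨c, hc⟩ := by
    by_contra! hno
    have hlt : ∀ c (hc : c ∈ Sᶜ), G.Adj v c → c ≠ z → d ⟨c, hc⟩ < d ⟨v, hvS⟩ := by
      intro c hc hvc hcz
      refine lt_of_le_of_ne (hno c hc hvc hcz) (htree.dist_ne_of_adj _ ?_)
      exact hvc.symm
    have heq : ∀ c c', G.Adj v c → G.Adj v c' → c ≠ z → c' ≠ z → c = c' := by
      intro c c' hvc hvc' hcz hcz'
      have := htree.eq_of_adj_of_dist_lt (u := ⟨c, hvN c hvc⟩) (v := ⟨c', hvN c' hvc'⟩)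
        (w := ⟨v, hvS⟩) hvc.symm hvc'.symm (hlt _ _ hvc hcz) (hlt _ _ hvc' hcz')
      simpa using this
    have h3 := hdeg v
    rw [← card_neighborFinset_eq_degree] at h3
    obtain ⟨a, ha, b, hb, c, hc, hab, hac, hbc⟩ := Finset.two_lt_card.1 h3
    simp only [mem_neighborFinset] at ha hb hc
    by_cases haz : a = z
    · exact hbc (heq b c hb hc (haz ▸ hab.symm) (haz ▸ hac.symm))
    by_cases hbz : b = z
    · exact hac (heq a c ha hc haz (hbz ▸ hbc.symm))
    exact hab (heq a b ha hb haz hbz)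
  have hcx : c ≠ x := by
    rintro rfl
    simp [d] at hcd
  have hcC : G.ZeroForces T c := by
    by_contra h
    exact absurd (hmax ⟨c, hc⟩ h) (by omega)
  refine hvU (.force hcC hvc.symm fun u hcu huv => ?_)
  by_cases hu : u ∈ S
  · exact .init (hT u hu c hc hcu.symm hcx hcz).1
  · by_contra hun
    have hud := hmax ⟨u, hu⟩ hun
    have := htree.eq_of_adj_of_dist_lt (u := ⟨u, hu⟩) (v := ⟨v, hvS⟩) (w := ⟨c, hc⟩)
      hcu.symm hvc (lt_of_le_of_lt hud hcd) hcd
    exact huv (by simpa using this)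

/-- A zero forcing set of minimum size cannot be made smaller by exchanging two of its vertices
for one new vertex. -/
theorem not_zeroForces_insert_diff_pair [Finite V] {S : Set V} (hzf : G.IsZeroForcingSet S)
    (hmin : ∀ T : Set V, G.IsZeroForcingSet T → S.ncard ≤ T.ncard) {x a c : V}
    (ha : a ∈ S) (hc : c ∈ S) (hac : a ≠ c)
    (hTa : G.ZeroForces (insert x (S \ {a, c})) a) :
    ¬ G.ZeroForces (insert x (S \ {a, c})) c := by
  intro hTc
  have hT := hmin (insert x (S \ {a, c})) fun v => (hzf v).trans fun s hs => by
    by_cases hsa : s = a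
    · exact hsa ▸ hTa
    by_cases hsc : s = c
    · exact hsc ▸ hTc
    exact .init (Or.inr ⟨hs, by simp [hsa, hsc]⟩)
  have h1 := Set.ncard_insert_le x (S \ {a, c})
  have h2 := Set.ncard_sdiff (s := {a, c}) (t := S) (by grind)
  rw [Set.ncard_pair hac] at h2
  have h3 : 2 ≤ S.ncard := by
    rw [← Set.ncard_pair hac]
    exact Set.ncard_le_ncard (by grind)
  omega

end SimpleGraph

/-- In the setting of Statement 10, if `X = N(x) ∩ S` is a clique of `G`,
then there is a unique vertex `y ∈ S` with `N(y) = X ∪ {z}` (where `z ∈ S̄` is the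
unique neighbor of `y` in `S̄`), and the degree of `z` in the tree `G[S̄]` is `Δ − 1`. -/
theorem stmt11 {V : Type*} [Fintype V] (G : SimpleGraph V) [DecidableRel G.Adj]
    (n Δ : ℕ) (hn : Fintype.card V = n) (hΔ3 : 3 ≤ Δ)
    (hreg : G.IsRegularOfDegree Δ) (hconn : G.Connected)
    (hZ : (Δ - 1) * G.zeroForcingNumber = (Δ - 2) * n + 2)
    (S : Set V) (hzf : G.IsZeroForcingSet S)
    (hSc : (G.induce Sᶜ).Connected)
    (hmin : ∀ T : Set V, G.IsZeroForcingSet T → (G.induce Tᶜ).Connected →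
      S.ncard ≤ T.ncard)
    (htree : (G.induce Sᶜ).IsTree)
    (hone : ∀ v ∈ S, {w : V | w ∈ Sᶜ ∧ G.Adj v w}.ncard = 1)
    (hcard2 : 2 ≤ (Sᶜ : Set V).ncard)
    (x : V) (hx : x ∈ Sᶜ) (hleaf : {w : V | w ∈ Sᶜ ∧ G.Adj x w}.ncard = 1)
    (hclique : ∀ a ∈ G.neighborSet x ∩ S, ∀ b ∈ G.neighborSet x ∩ S, a ≠ b → G.Adj a b) :
    (∃! y : V, y ∈ S ∧ ∃ z ∈ Sᶜ,
        G.neighborSet y = (G.neighborSet x ∩ S) ∪ {z}) ∧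
      (∀ y ∈ S, ∀ z ∈ Sᶜ, G.neighborSet y = (G.neighborSet x ∩ S) ∪ {z} →
        {w : V | w ∈ Sᶜ ∧ G.Adj z w}.ncard = Δ - 1) := by
  classical
  have hsize := SimpleGraph.ncard_of_isTree_induce_compl (by omega) hreg htree hone
  have hmin' : ∀ T : Set V, G.IsZeroForcingSet T → S.ncard ≤ T.ncard := by
    intro T hT
    have h1 : G.zeroForcingNumber ≤ T.ncard := Nat.sInf_le ⟨T, hT, rfl⟩
    rw [hn, ← hZ] at hsize
    exact (Nat.eq_of_mul_eq_mul_left (by omega) hsize).trans_le h1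
  have huniq : ∀ s ∈ S, ∀ u ∈ Sᶜ, ∀ w ∈ Sᶜ, G.Adj s u → G.Adj s w → u = w := by
    intro s hs u hu w hw hsu hsw
    obtain ⟨t, ht⟩ := Set.ncard_eq_one.1 (hone s hs)
    have h1 : u ∈ ({t} : Set V) := ht ▸ ⟨hu, hsu⟩
    have h2 : w ∈ ({t} : Set V) := ht ▸ ⟨hw, hsw⟩
    exact h1.trans h2.symm
  have hout : ∀ s ∈ S, ∃ w ∈ Sᶜ, G.Adj s w := by
    intro s hs
    obtain ⟨t, ht⟩ := Set.ncard_eq_one.1 (hone s hs)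
    exact ⟨t, ht.ge rfl⟩
  set X := G.neighborSet x ∩ S with hX
  have hXcard : X.ncard = Δ - 1 := by
    have := G.ncard_neighborSet_inter_add S x
    rw [hleaf, hreg, ← hX] at this
    omega
  have hxX : x ∉ X := fun h => hx h.2
  have hnb : ∀ v, (G.neighborSet v).ncard = Δ := by
    intro v
    rw [← hreg v, ← G.card_neighborSet_eq_degree, ← Nat.card_eq_fintype_card,
      Nat.card_coe_set_eq]
  -- Each vertex of the clique has exactly one neighbor besides `x` and the clique.
  have hext : ∀ a ∈ X, ∃ c ∈ S, c ∉ X ∧ G.Adj a c ∧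
      ∀ u, G.Adj a u → u = x ∨ u ∈ X ∨ u = c := by
    intro a ha
    have hsub : insert x (X \ {a}) ⊆ G.neighborSet a := by
      rintro u (rfl | ⟨hu, hua⟩)
      · exact ha.1.symm
      · exact hclique a ha u hu (Ne.symm hua)
    have hcard := Set.ncard_sdiff hsub
    rw [Set.ncard_insert_of_notMem (by grind), Set.ncard_sdiff_singleton_of_mem ha, hXcard,
      hnb] at hcard
    obtain ⟨c, hc⟩ := Set.ncard_eq_one.1 (hcard.trans (by omega))
    have hc' : c ∈ G.neighborSet a \ insert x (X \ {a}) := hc ▸ rfl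
    have hac : G.Adj a c := hc'.1
    have hcX : c ∉ X := fun h => hc'.2 (Or.inr ⟨h, hac.ne'⟩)
    refine ⟨c, ?_, hcX, hac, fun u hu => ?_⟩
    · by_contra hcS
      exact hc'.2 (Or.inl (huniq a ha.2 c hcS x hx hac ha.1.symm))
    · by_cases h : u ∈ insert x (X \ {a})
      · rcases h with h | h
        · exact Or.inl h
        · exact Or.inr (Or.inl h.1)
      · exact Or.inr (Or.inr (hc.le ⟨hu, h⟩))
  obtain ⟨a, ha, b, hb, hab⟩ := (Set.one_lt_ncard).1 (show 1 < X.ncard by omega)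
  obtain ⟨y, hyS, hyX, hay, hya⟩ := hext a ha
  have hXy : ∀ b ∈ X, G.Adj b y := by
    intro b hb
    by_cases hab : b = a
    · exact hab ▸ hay
    obtain ⟨c, hcS, hcX, hbc, hbN⟩ := hext b hb
    by_contra hby
    have hyc : y ≠ c := by rintro rfl; exact hby hbc
    have hne : a ≠ y := hay.ne
    have hbT : b ∈ insert x (S \ {a, y}) :=
      Or.inr ⟨hb.2, by have : b ≠ y := by rintro rfl; exact hyX hb
                       simp [hab, this]⟩
    have hTX : ∀ u ∈ X, u ≠ a → u ∈ insert x (S \ {a, y}) := by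
      intro u hu hua
      exact Or.inr ⟨hu.2, by grind⟩
    have hTa : G.ZeroForces (insert x (S \ {a, y})) a := by
      refine .force (.init hbT) (hclique b hb a ha hab) fun u hu hua => .init ?_
      rcases hbN u hu with rfl | h | rfl
      · exact Or.inl rfl
      · exact hTX u h hua
      · exact Or.inr ⟨hcS, by grind⟩
    refine SimpleGraph.not_zeroForces_insert_diff_pair hzf hmin' ha.2 hyS hne hTa
      (.force hTa hay fun u hu huy => ?_)
    rcases hya u hu with rfl | h | rfl
    · exact .init (Or.inl rfl)
    · exact .init (hTX u h hu.ne')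
    · exact absurd rfl huy
  obtain ⟨z, hzS, hyz⟩ := hout y hyS
  have hyN : G.neighborSet y = X ∪ {z} := by
    symm
    refine Set.eq_of_subset_of_ncard_le ?_ ?_ (Set.toFinite _)
    · rintro u (hu | rfl)
      · exact (hXy u hu).symm
      · exact hyz
    · rw [hnb, Set.union_singleton, Set.ncard_insert_of_notMem (fun h => hzS h.2), hXcard]
      omega
  have hyuniq : ∀ y' ∈ S, ∀ z' ∈ Sᶜ, G.neighborSet y' = X ∪ {z'} → y' = y := by
    intro y' hy' z' hz' hN
    have hay' : G.Adj y' a := hN.ge (Or.inl ha)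
    rcases hya y' hay'.symm with rfl | h | h
    · exact absurd hy' hx
    · have : y' ∈ G.neighborSet y' := hN.ge (Or.inl h)
      exact absurd this (G.loopless.irrefl y')
    · exact h
  refine ⟨⟨y, ⟨hyS, z, hzS, hyN⟩, fun y' ⟨hy', z', hz', hN⟩ => hyuniq y' hy' z' hz' hN⟩, ?_⟩
  intro y' hy' z' hz' hN
  obtain rfl := hyuniq y' hy' z' hz' hN
  obtain rfl : z' = z := huniq y' hyS z' hz' z hzS (hN.ge (Or.inr rfl)) hyz
  have hzy : G.neighborSet z' ∩ S = {y'} := by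
    refine Set.Subset.antisymm (fun s ⟨hzs, hs⟩ => ?_) ?_
    · by_contra hsy
      change s ≠ y' at hsy
      have hzx : z' ≠ x := by
        rintro rfl
        exact hyX ⟨hyz.symm, hyS⟩
      have hXnb : ∀ u ∈ X, ∀ t, G.Adj u t → t = x ∨ t ∈ X ∨ t = y' := by
        intro u hu t hut
        obtain ⟨c, hcS, hcX, huc, huN⟩ := hext u hu
        have h1 := huN t hut
        have h2 := huN y' (hXy u hu)
        grind
      have hxT : G.ZeroForces (insert x (S \ {a, y'})) x := .init (Or.inl rfl)
      have hfar : ∀ t ∈ S, ∀ c ∈ Sᶜ, G.Adj t c → c ≠ x → t ≠ y' →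
          t ∈ insert x (S \ {a, y'}) ∧ ∀ u ∈ S, G.Adj t u → u ∈ insert x (S \ {a, y'}) := by
        intro t ht c hc htc hcx hty
        have htX : t ∉ X := fun h => hcx (huniq t ht c hc x hx htc h.1.symm)
        have hta : t ≠ a := by rintro rfl; exact htX ha
        refine ⟨Or.inr ⟨ht, by simp [hta, hty]⟩, fun u hu htu => Or.inr ⟨hu, ?_⟩⟩
        rintro (rfl | rfl)
        · rcases hXnb u ha t htu.symm with rfl | h | h
          · exact hx ht
          · exact htX h
          · exact hty h
        · rcases hyN.le htu.symm with h | rfl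
          · exact htX h
          · exact hzS ht
      have hzT : G.ZeroForces (insert x (S \ {a, y'})) z' := by
        obtain ⟨hsT, hsN⟩ := hfar s hs z' hzS hzs.symm hzx hsy
        refine .force (.init hsT) hzs.symm fun u hsu huz => ?_
        by_cases hu : u ∈ S
        · exact .init (hsN u hu hsu)
        · exact absurd (huniq s hs u hu z' hzS hsu hzs.symm) huz
      have htreeT : ∀ v ∈ Sᶜ, G.ZeroForces (insert x (S \ {a, y'})) v := fun v hv =>
        SimpleGraph.zeroForces_compl_of_isTree (fun v => (hreg v).symm ▸ hΔ3) htree huniq hx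
          hxT hzT (fun t ht c hc htc hcx hcz => hfar t ht c hc htc hcx (by
            rintro rfl
            exact hcz (huniq t ht c hc z' hzS htc hyz))) hv
      have hTX : ∀ u ∈ X, u ≠ a → G.ZeroForces (insert x (S \ {a, y'})) u := fun u hu hua =>
        .init (Or.inr ⟨hu.2, by grind⟩)
      have hTa : G.ZeroForces (insert x (S \ {a, y'})) a := by
        refine .force hxT ha.1 fun u hxu hua => ?_
        by_cases hu : u ∈ S
        · exact hTX u ⟨hxu, hu⟩ hua
        · exact htreeT u hu
      refine SimpleGraph.not_zeroForces_insert_diff_pair hzf hmin' ha.2 hyS hay.ne hTa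
        (.force hTa hay fun u hu huy => ?_)
      rcases hXnb a ha u hu with rfl | h | h
      · exact hxT
      · exact hTX u h hu.ne'
      · exact absurd h huy
    · rintro _ rfl
      exact ⟨hyz.symm, hyS⟩
  have := G.ncard_neighborSet_inter_add S z'
  rw [hzy, Set.ncard_singleton, hreg] at this
  omega
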